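/- Let ℓ ≥ 3 be an integer and let G be a finite connected edge-transitive simple graph containing a path P of length ℓ that does not close to a cycle. Then the line graph L(G) is vertex-transitive, and the sequence of edges of P along P is an induced path of length ℓ − 1 in L(G) that does not close to an induced cycle in L(G). -/

import Mathlib

open SimpleGraph

/-- A walk `P` (typically a path) in `G` *closes to a cycle* if there is a cycle `C` in `G`
such that every edge of `P` is an edge of `C`. -/
def ClosesToCycle {V : Type*} (G : SimpleGraph V) {u v : V} (P : G.Walk u v) : Prop :=
  ∃ (w : V) (C : G.Walk w w), C.IsCycle ∧ ∀ e ∈ P.edges, e ∈ C.edges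

/-- A walk is *induced* if any two of its vertices that are adjacent in `G` are consecutive
on the walk, i.e. the corresponding edge is an edge of the walk. -/
def InducedWalk {V : Type*} (G : SimpleGraph V) {u v : V} (P : G.Walk u v) : Prop :=
  ∀ x ∈ P.support, ∀ y ∈ P.support, G.Adj x y → s(x, y) ∈ P.edges

/-- An induced path `P` *closes to an induced cycle* if there is an induced cycle `C` in `G`
such that every vertex of `P` is a vertex of `C` and every edge of `P` is an edge of `C`. -/
def ClosesToInducedCycle {V : Type*} (G : SimpleGraph V) {u v : V} (P : G.Walk u v) : Prop :=
  ∃ (w : V) (C : G.Walk w w), C.IsCycle ∧ InducedWalk G C ∧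
    (∀ x ∈ P.support, x ∈ C.support) ∧ (∀ e ∈ P.edges, e ∈ C.edges)

/-- `G` is vertex-transitive. -/
def VertexTransitive {V : Type*} (G : SimpleGraph V) : Prop :=
  ∀ u v : V, ∃ φ : G ≃g G, φ u = v

/-- `G` is edge-transitive. -/
def EdgeTransitive {V : Type*} (G : SimpleGraph V) : Prop :=
  ∀ e ∈ G.edgeSet, ∀ f ∈ G.edgeSet, ∃ φ : G ≃g G, Sym2.map φ e = f

lemma Set.eq_or_eq_of_mem_of_ncard_eq_two {α : Type*} {s : Set α} (hs : s.ncard = 2) {a b c : α}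
    (ha : a ∈ s) (hb : b ∈ s) (hab : a ≠ b) (hc : c ∈ s) : c = a ∨ c = b := by
  obtain ⟨x, y, -, rfl⟩ := Set.ncard_eq_two.mp hs
  simp only [Set.mem_insert_iff, Set.mem_singleton_iff] at ha hb hc
  grind

namespace SimpleGraph

variable {V : Type*} {G : SimpleGraph V}

lemma _root_.EdgeTransitive.vertexTransitive_lineGraph (h : EdgeTransitive G) :
    VertexTransitive G.lineGraph := by
  rintro ⟨e, he⟩ ⟨f, hf⟩
  obtain ⟨φ, hφ⟩ := h e he f hf
  exact ⟨φ.lineGraph, Subtype.ext hφ⟩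

/-- The line graph walk along a path with at least one edge. -/
lemma Walk.IsPath.exists_lineGraph_walk {u v w : V} (h : G.Adj u v) (p : G.Walk v w)
    (hp : (cons h p).IsPath) :
    ∃ (e : G.edgeSet) (q : G.lineGraph.Walk ⟨s(u, v), h⟩ e),
      q.support.map Subtype.val = (cons h p).edges ∧ InducedWalk G.lineGraph q := by
  induction p generalizing u with
  | nil => exact ⟨_, .nil, by simp, by simp [InducedWalk]⟩
  | @cons v x w h' p ih =>
    have hp' := hp.of_cons
    obtain ⟨e, q, hq, hind⟩ := ih h' hp'
    have hu : u ∉ (cons h' p).support := ((cons_isPath_iff _ _).mp hp).2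
    have hadj : G.lineGraph.Adj ⟨s(u, v), h⟩ ⟨s(v, x), h'⟩ := by
      rw [lineGraph_adj_iff_exists]
      refine ⟨fun heq ↦ hu ?_, v, by simp, by simp⟩
      have : u ∈ s(v, x) := by
        rw [← Subtype.mk.inj heq]; simp
      exact mem_support_of_mem_edges (e := s(v, x)) (by simp) this
    have key : ∀ y ∈ q.support, G.lineGraph.Adj ⟨s(u, v), h⟩ y →
        y = ⟨s(v, x), h'⟩ := by
      intro y hy hay
      have hy' : y.val ∈ (cons h' p).edges := hq ▸ List.mem_map_of_mem hy
      obtain ⟨-, z, hz, hzy⟩ := lineGraph_adj_iff_exists.mp hay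
      rcases Sym2.mem_iff.mp hz with rfl | rfl
      · exact absurd (mem_support_of_mem_edges hy' hzy) hu
      · rw [edges_cons, List.mem_cons] at hy'
        refine Subtype.ext (hy'.resolve_right fun hyp ↦ ?_)
        exact ((cons_isPath_iff _ _).mp hp').2 (mem_support_of_mem_edges hyp hzy)
    refine ⟨e, .cons hadj q, by simp [hq], fun a ha b hb hab ↦ ?_⟩
    rw [support_cons, List.mem_cons] at ha hb
    rw [edges_cons, List.mem_cons]
    rcases ha with rfl | ha <;> rcases hb with rfl | hb
    · exact absurd hab (G.lineGraph.loopless.irrefl _)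
    · exact .inl (by rw [key b hb hab])
    · exact .inl (by rw [key a ha hab.symm, Sym2.eq_swap])
    · exact .inr (hind a ha b hb hab)

/-- An induced cycle containing a triangle is that triangle. -/
lemma Walk.IsCycle.eq_of_mem_support_of_triangle {r : V} {C : G.Walk r r} (hC : C.IsCycle)
    (hind : InducedWalk G C) {x y z : V} (hx : x ∈ C.support) (hy : y ∈ C.support)
    (hz : z ∈ C.support) (hxy : G.Adj x y) (hyz : G.Adj y z) (hxz : G.Adj x z)
    {w : V} (hw : w ∈ C.support) : w = x ∨ w = y ∨ w = z := by
  classical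
  by_contra hne
  have key : ∀ {a b c : V}, a ∈ C.support → b ∈ C.support → c ∈ C.support → G.Adj a b →
      G.Adj a c → b ≠ c → ∀ d, s(a, d) ∈ C.edges → d = b ∨ d = c := by
    intro a b c ha hb hc hab hac hbc d hd
    refine Set.eq_or_eq_of_mem_of_ncard_eq_two (hC.ncard_neighborSet_toSubgraph_eq_two ha)
      ?_ ?_ hbc ?_ <;> rw [Subgraph.mem_neighborSet, adj_toSubgraph_iff_mem_edges]
    exacts [hind a ha b hb hab, hind a ha c hc hac, hd]
  have hw' : w ∈ (C.rotate x hx).support := by simpa using hw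
  obtain ⟨d, hd, hd1, hd2⟩ :=
    ((C.rotate x hx).takeUntil w hw').exists_boundary_dart {x, y, z} (by simp) (by simpa using hne)
  have hd' : s(d.fst, d.snd) ∈ C.edges :=
    (C.rotate_edges x hx).mem_iff.mp <|
      edges_takeUntil_subset_edges _ hw' (List.mem_map_of_mem (f := Dart.edge) hd)
  simp only [Set.mem_insert_iff, Set.mem_singleton_iff] at hd1 hd2
  rcases hd1 with h1 | h1 | h1 <;> rw [h1] at hd'
  · have := key hx hy hz hxy hxz hyz.ne _ hd'
    tauto
  · have := key hy hx hz hxy.symm hyz hxz.ne _ hd'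
    tauto
  · have := key hz hx hy hxz.symm hyz.symm hxy.ne _ hd'
    tauto

/-- The edges of `G` on an induced cycle of the line graph, other than a triangle, form
a disjoint union of cycles. -/
lemma Walk.IsCycle.isCycles_fromEdgeSet_of_lineGraph {r : G.edgeSet} {C : G.lineGraph.Walk r r}
    (hC : C.IsCycle) (hind : InducedWalk G.lineGraph C)
    (htri : ∀ x ∈ C.support, ∀ y ∈ C.support, ∀ z ∈ C.support, G.lineGraph.Adj x y →
      G.lineGraph.Adj y z → ¬ G.lineGraph.Adj x z) :
    (fromEdgeSet {e | e ∈ C.support.map Subtype.val}).IsCycles := by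
  rintro v ⟨w, hvw⟩
  simp only [mem_neighborSet, fromEdgeSet_adj, Set.mem_ofPred_eq, List.mem_map] at hvw
  obtain ⟨⟨f, hf, hfe⟩, hne⟩ := hvw
  obtain ⟨g, k, hgk, hset⟩ := Set.ncard_eq_two.mp (hC.ncard_neighborSet_toSubgraph_eq_two hf)
  have hmem : ∀ x, C.toSubgraph.Adj f x ↔ x = g ∨ x = k := fun x ↦ by
    rw [← Subgraph.mem_neighborSet, hset]; simp
  have hadj : ∀ x, C.toSubgraph.Adj f x → x ∈ C.support ∧ G.lineGraph.Adj f x := fun x hx ↦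
    ⟨C.mem_verts_toSubgraph.mp hx.snd_mem, hx.adj_sub⟩
  obtain ⟨hg, hfg⟩ := hadj g ((hmem g).mpr (.inl rfl))
  obtain ⟨hk, hfk⟩ := hadj k ((hmem k).mpr (.inr rfl))
  have hnot : ∀ a, a ∈ g.val → a ∉ k.val := fun a hag hak ↦
    htri f hf g hg k hk hfg (lineGraph_adj_iff_exists.mpr ⟨hgk, a, hag, hak⟩) hfk
  have main : ∀ g k : G.edgeSet, g ∈ C.support → G.lineGraph.Adj f g →
      (∀ x, C.toSubgraph.Adj f x → x = g ∨ x = k) → v ∈ g.val → v ∉ k.val →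
      ((fromEdgeSet {e | e ∈ C.support.map Subtype.val}).neighborSet v).ncard = 2 := by
    intro g k hg hfg hnb hvg hvk
    obtain ⟨w', hw'⟩ := Sym2.mem_iff_exists.mp hvg
    have hvw' : G.Adj v w' := by simpa [hw'] using g.2
    refine Set.ncard_eq_two.mpr ⟨w, w', ?_, ?_⟩
    · rintro rfl
      exact hfg.ne (Subtype.ext (hfe.trans hw'.symm))
    ext t
    simp only [mem_neighborSet, fromEdgeSet_adj, Set.mem_ofPred_eq, List.mem_map,
      Set.mem_insert_iff, Set.mem_singleton_iff]
    constructor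
    · rintro ⟨⟨e, he, het⟩, -⟩
      by_cases hef : f = e
      · subst hef
        exact .inl (Sym2.congr_right.mp (het.symm.trans hfe))
      · have hfe' : G.lineGraph.Adj f e :=
          lineGraph_adj_iff_exists.mpr ⟨hef, v, by simp [hfe], by simp [het]⟩
        rcases hnb e (adj_toSubgraph_iff_mem_edges.mpr (hind f hf e he hfe')) with rfl | rfl
        · exact .inr (Sym2.congr_right.mp (het.symm.trans hw'))
        · exact absurd (by simp [het]) hvk
    · rintro (rfl | rfl)
      · exact ⟨⟨f, hf, hfe⟩, hne⟩
      · exact ⟨⟨g, hg, hw'⟩, hvw'.ne⟩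
  obtain ⟨-, a, haf, hag⟩ := lineGraph_adj_iff_exists.mp hfg
  obtain ⟨-, b, hbf, hbk⟩ := lineGraph_adj_iff_exists.mp hfk
  rw [hfe, Sym2.mem_iff] at haf hbf
  by_cases hvg : v ∈ g.val
  · exact main g k hg hfg (fun x hx ↦ (hmem x).mp hx) hvg (hnot v hvg)
  · refine main k g hk hfk (fun x hx ↦ ((hmem x).mp hx).symm) ?_ hvg
    grind

/-- A nontrivial walk all of whose edges lie in a disjoint union of cycles closes to a cycle. -/
lemma IsCycles.closesToCycle [Finite V] {H : SimpleGraph V} (hH : H.IsCycles) (hHG : H ≤ G)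
    {u v : V} (p : G.Walk u v) (hp : ¬ p.Nil) (hpH : ∀ e ∈ p.edges, e ∈ H.edgeSet) :
    ClosesToCycle G p := by
  classical
  have := Fintype.ofFinite V
  have hn : (H.neighborSet u).Nonempty :=
    ⟨p.snd, hpH _ (p.mk_start_snd_mem_edges hp)⟩
  obtain ⟨D, hD, hDv⟩ := hH.exists_cycle_toSubgraph_verts_eq_connectedComponentSupp
    (c := H.connectedComponentMk u) rfl hn
  refine ⟨u, D.mapLe hHG, hD.mapLe hHG, fun e he ↦ ?_⟩
  rw [Walk.edges_mapLe_eq_edges]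
  induction e with | h a b =>
  have ha : a ∈ D.toSubgraph.verts := by
    rw [hDv, ConnectedComponent.mem_supp_iff, ConnectedComponent.eq]
    have ha' : a ∈ (p.transfer H hpH).support := by
      simpa using p.fst_mem_support_of_mem_edges he
    exact ((p.transfer H hpH).takeUntil a ha').reachable.symm
  rw [← Walk.adj_toSubgraph_iff_mem_edges, hD.adj_toSubgraph_iff_of_isCycles hH ha]
  exact hpH _ he

/-- A path of length at least `3` whose edges all lie on an induced cycle of the line graph
closes to a cycle. -/
lemma Walk.IsPath.closesToCycle_of_lineGraph [Finite V] {u v : V} {p : G.Walk u v} (hp : p.IsPath)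
    (hlen : 3 ≤ p.length) {r : G.edgeSet} {C : G.lineGraph.Walk r r} (hC : C.IsCycle)
    (hind : InducedWalk G.lineGraph C)
    (hpC : ∀ e ∈ p.edges, e ∈ C.support.map Subtype.val) : ClosesToCycle G p := by
  have hcyc := hC.isCycles_fromEdgeSet_of_lineGraph hind ?_
  · refine hcyc.closesToCycle ?_ p ?_ fun e he ↦ ?_
    · intro a b hab
      simp only [fromEdgeSet_adj, Set.mem_ofPred_eq, List.mem_map] at hab
      obtain ⟨⟨f, -, hf⟩, -⟩ := hab
      exact G.mem_edgeSet.mp (hf ▸ f.2)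
    · rw [← length_eq_zero_iff]
      omega
    · rw [edgeSet_fromEdgeSet]
      exact ⟨hpC e he, G.not_isDiag_of_mem_edgeSet (p.edges_subset_edgeSet he)⟩
  · intro x hx y hy z hz hxy hyz hxz
    have htri : ∀ e ∈ C.support, ∀ f ∈ C.support, e ≠ f → G.lineGraph.Adj e f := by
      intro e he f hf hef
      have h1 := hC.eq_of_mem_support_of_triangle hind hx hy hz hxy hyz hxz he
      have h2 := hC.eq_of_mem_support_of_triangle hind hx hy hz hxy hyz hxz hf
      have := hxy.symm
      have := hyz.symm
      have := hxz.symm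
      grind
    match p, hp, hlen, hpC with
    | .cons (v := a) h1 (.cons (v := b) h2 (.cons (v := c) h3 p)), hp, _, hpC =>
      simp only [edges_cons, List.mem_cons, forall_eq_or_imp, List.mem_map] at hpC
      obtain ⟨⟨f, hf, hfe⟩, -, ⟨g, hg, hge⟩, -⟩ := hpC
      have hdisj : ∀ x ∈ f.val, x ∉ g.val := by
        rw [hfe, hge]
        have := p.start_mem_support
        simp only [isPath_def, support_cons, List.nodup_cons, List.mem_cons] at hp
        simp only [Sym2.mem_iff]
        grind
      have hne : f ≠ g := by
        rintro rfl
        exact hdisj u (by simp [hfe]) (by simp [hfe])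
      obtain ⟨-, x, hxf, hxg⟩ := lineGraph_adj_iff_exists.mp (htri f hf g hg hne)
      exact hdisj x hxf hxg

end SimpleGraph

/-- Let `ℓ ≥ 3` and let `G` be a finite connected edge-transitive graph with a
path `P` of length `ℓ` not closing to a cycle. Then `L(G)` is vertex-transitive and the
sequence of edges of `P` is an induced path of length `ℓ - 1` in `L(G)` that does not close
to an induced cycle in `L(G)`. -/
theorem lineGraph_counterexample_of_edgeTransitive
    {V : Type*} [Fintype V] (G : SimpleGraph V)
    (hconn : G.Connected) (het : EdgeTransitive G)
    (ℓ : ℕ) (hℓ : 3 ≤ ℓ) {u v : V} (P : G.Walk u v)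
    (hP : P.IsPath) (hlen : P.length = ℓ) (hnc : ¬ ClosesToCycle G P) :
    VertexTransitive G.lineGraph ∧
    ∃ (e₀ e₁ : G.edgeSet) (P' : G.lineGraph.Walk e₀ e₁),
      P'.IsPath ∧ InducedWalk G.lineGraph P' ∧ P'.length = ℓ - 1 ∧
      P'.support.map Subtype.val = P.edges ∧
      ¬ ClosesToInducedCycle G.lineGraph P' := by
  refine ⟨het.vertexTransitive_lineGraph, ?_⟩
  match P, hP, hlen, hnc with
  | .nil, _, hlen, _ => simp at hlen; omega
  | .cons h p, hP, hlen, hnc =>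
    obtain ⟨e, q, hq, hind⟩ := hP.exists_lineGraph_walk
    refine ⟨_, e, q, ?_, hind, ?_, hq, ?_⟩
    · rw [Walk.isPath_def]
      exact .of_map Subtype.val (hq ▸ hP.isTrail.edges_nodup)
    · have := congrArg List.length hq
      rw [List.length_map, Walk.length_support, Walk.length_edges] at this
      omega
    · rintro ⟨r, C, hC, hCind, hsupp, -⟩
      refine hnc (hP.closesToCycle_of_lineGraph (by omega) hC hCind fun f hf ↦ ?_)
      rw [← hq] at hf
      exact List.map_subset _ hsupp hf
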